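/- arXiv:2206.05632 — 5 statements merged into one kernel-verified Lean document; each statement's English description precedes it below -/
import Mathlib

section
/- Let a, b be real numbers with 0 < |a| < |b|. Then the function f : ℝ → ℝ defined by f(x) = (1 + a²x²)/(1 + b²x²) is positive definite; that is, for every n and all real numbers x₁, …, xₙ, the n×n matrix with (i,j) entry f(xᵢ − xⱼ) is positive semidefinite. -/
open MeasureTheory Set in
/-- The Cauchy kernel is the cosine transform of the exponential density. -/
theorem integrableOn_and_integral_exp_neg_mul_cos (y : ℝ) :
    IntegrableOn (fun t : ℝ => Real.exp (-t) * Real.cos (t * y)) (Ioi 0) ∧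
      ∫ t in Ioi (0 : ℝ), Real.exp (-t) * Real.cos (t * y) = 1 / (1 + y ^ 2) := by
  have hre : ((-1 + y * Complex.I : ℂ)).re < 0 := by simp
  have hfun : (fun t : ℝ => Real.exp (-t) * Real.cos (t * y)) =
      fun t : ℝ => RCLike.re (Complex.exp ((-1 + y * Complex.I) * t)) := by
    funext t
    simp [Complex.exp_re, mul_comm]
  have hint : Integrable (fun t : ℝ => Complex.exp ((-1 + y * Complex.I) * t))
      (volume.restrict (Ioi 0)) :=
    integrableOn_exp_mul_complex_Ioi hre 0
  rw [hfun]
  refine ⟨hint.re, ?_⟩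
  rw [integral_re hint, integral_exp_mul_complex_Ioi hre 0]
  simp [Complex.div_re, Complex.normSq_apply]
  ring

open MeasureTheory Set in
/-- The quadratic form of the Cauchy kernel `x ↦ 1 / (1 + x²)` is nonnegative. -/
theorem sum_sum_mul_one_div_one_add_sq_nonneg {ι : Type*} [Fintype ι] (x c : ι → ℝ) :
    0 ≤ ∑ i, ∑ j, c i * c j * (1 / (1 + (x i - x j) ^ 2)) := by
  have key : ∑ i, ∑ j, c i * c j * (1 / (1 + (x i - x j) ^ 2)) =
      ∫ t in Ioi (0 : ℝ), ∑ i, ∑ j, c i * c j *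
        (Real.exp (-t) * Real.cos (t * (x i - x j))) := by
    have hint (i j : ι) : IntegrableOn (fun t : ℝ => c i * c j *
        (Real.exp (-t) * Real.cos (t * (x i - x j)))) (Ioi 0) :=
      (integrableOn_and_integral_exp_neg_mul_cos (x i - x j)).1.const_mul (c i * c j)
    rw [integral_finsetSum _ fun i _ => integrable_finsetSum _ fun j _ => hint i j]
    refine Finset.sum_congr rfl fun i _ => ?_
    rw [integral_finsetSum _ fun j _ => hint i j]
    refine Finset.sum_congr rfl fun j _ => ?_
    rw [integral_const_mul, (integrableOn_and_integral_exp_neg_mul_cos (x i - x j)).2]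
  rw [key]
  refine integral_nonneg fun t => ?_
  have hsq : ∑ i, ∑ j, c i * c j * (Real.exp (-t) * Real.cos (t * (x i - x j))) =
      Real.exp (-t) * ((∑ i, c i * Real.cos (t * x i)) ^ 2 +
        (∑ i, c i * Real.sin (t * x i)) ^ 2) := by
    simp only [sq, Finset.sum_mul_sum]
    simp only [← Finset.sum_add_distrib, Finset.mul_sum]
    refine Finset.sum_congr rfl fun i _ => Finset.sum_congr rfl fun j _ => ?_
    rw [mul_sub, Real.cos_sub]
    ring
  simp only [hsq, Pi.zero_apply]
  positivity

/-- The function `x ↦ (1 + a²x²)/(1 + b²x²)` is positive definite when `0 < |a| < |b|`. -/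
theorem rational_quotient_posDef (a b : ℝ) (ha : 0 < |a|) (hab : |a| < |b|)
    (n : ℕ) (x : Fin n → ℝ) :
    (Matrix.of fun i j : Fin n =>
      (1 + a ^ 2 * (x i - x j) ^ 2) / (1 + b ^ 2 * (x i - x j) ^ 2)).PosSemidef := by
  have hb : b ≠ 0 := abs_pos.mp (ha.trans hab)
  have hr : a ^ 2 / b ^ 2 ≤ 1 := (div_le_one (by positivity)).mpr (sq_lt_sq.mpr hab).le
  refine Matrix.PosSemidef.of_dotProduct_mulVec_nonneg ?_ fun c => ?_
  · ext i j
    simp only [Matrix.conjTranspose_apply, Matrix.of_apply, star_trivial, sub_sq_comm (x j) (x i)]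
  · have hform : star c ⬝ᵥ (Matrix.of fun i j : Fin n =>
        (1 + a ^ 2 * (x i - x j) ^ 2) / (1 + b ^ 2 * (x i - x j) ^ 2)).mulVec c =
        a ^ 2 / b ^ 2 * (∑ i, c i) ^ 2 + (1 - a ^ 2 / b ^ 2) *
          ∑ i, ∑ j, c i * c j * (1 / (1 + (b * x i - b * x j) ^ 2)) := by
      simp only [dotProduct, Matrix.mulVec, Matrix.of_apply, star_trivial, sq (∑ i, c i),
        Finset.sum_mul_sum]
      simp only [Finset.mul_sum, ← Finset.sum_add_distrib]
      refine Finset.sum_congr rfl fun i _ => Finset.sum_congr rfl fun j _ => ?_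
      have hpos : 1 + b ^ 2 * (x i - x j) ^ 2 ≠ 0 := by positivity
      rw [← mul_sub, mul_pow]
      field_simp
      ring
    rw [hform]
    exact add_nonneg (by positivity) (mul_nonneg (sub_nonneg.mpr hr)
      (sum_sum_mul_one_div_one_add_sq_nonneg (fun i => b * x i) c))
end

section
/- Let α, β be real numbers of the same sign with |β| > |α| > 0. Then the function f : ℝ → ℝ defined by f(x) = sinh(αx)/sinh(βx) for x ≠ 0 and f(0) = α/β is positive definite; that is, for every n and all real numbers x₁, …, xₙ, the n×n matrix with (i,j) entry f(xᵢ − xⱼ) is positive semidefinite. (Lemma 2.1(ii)) -/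
open Filter Topology MeasureTheory

namespace Matrix.PosSemidef

/-- An entrywise limit of positive semidefinite real matrices is positive semidefinite. -/
theorem of_tendsto {ι κ : Type*} {l : Filter κ} [l.NeBot] {A : κ → Matrix ι ι ℝ}
    {M : Matrix ι ι ℝ} (hA : ∀ k, (A k).PosSemidef)
    (hM : ∀ i j, Tendsto (fun k => A k i j) l (𝓝 (M i j))) : M.PosSemidef := by
  refine ⟨?_, fun c => ?_⟩
  · ext i j
    refine tendsto_nhds_unique (hM j i) ((hM i j).congr fun k => ?_)
    exact ((hA k).isHermitian.apply j i)
  · have h : Tendsto (fun k => c.sum fun i ci => c.sum fun j cj => star ci * A k i j * cj) l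
        (𝓝 (c.sum fun i ci => c.sum fun j cj => star ci * M i j * cj)) :=
      tendsto_finsetSum _ fun i _ => tendsto_finsetSum _ fun j _ =>
        ((hM i j).const_mul _).mul_const _
    exact ge_of_tendsto' h fun k => (hA k).2 c

/-- An entrywise integral of positive semidefinite real matrices is positive semidefinite. -/
theorem of_integral {ι Ω : Type*} [MeasurableSpace Ω] {μ : Measure Ω} {A : Ω → Matrix ι ι ℝ}
    (hA : ∀ t, (A t).PosSemidef) (hint : ∀ i j, Integrable (fun t => A t i j) μ) :
    (Matrix.of fun i j => ∫ t, A t i j ∂μ).PosSemidef := by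
  refine ⟨?_, fun c => ?_⟩
  · ext i j
    exact integral_congr_ae (.of_forall fun t => (hA t).isHermitian.apply i j)
  · have h : (c.sum fun i ci => c.sum fun j cj =>
        star ci * (Matrix.of fun i j => ∫ t, A t i j ∂μ) i j * cj) =
        ∫ t, (c.sum fun i ci => c.sum fun j cj => star ci * A t i j * cj) ∂μ := by
      have hterm : ∀ i j, Integrable (fun t => star (c i) * A t i j * c j) μ := fun i j =>
        ((hint i j).const_mul _).mul_const _
      simp only [Finsupp.sum]
      rw [integral_finsetSum _ fun i _ => integrable_finsetSum _ fun j _ => hterm i j]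
      refine Finset.sum_congr rfl fun i _ => ?_
      rw [integral_finsetSum _ fun j _ => hterm i j]
      refine Finset.sum_congr rfl fun j _ => ?_
      rw [integral_mul_const, integral_const_mul, Matrix.of_apply]
    rw [h]
    exact integral_nonneg fun t => (hA t).2 c

theorem of_const {ι : Type*} [Finite ι] {a : ℝ} (ha : 0 ≤ a) :
    (Matrix.of fun _ _ : ι => a).PosSemidef := by
  have h : (Matrix.of fun _ _ : ι => a) = a • vecMulVec (fun _ => 1) (star fun _ => 1) := by
    ext i j
    simp [vecMulVec_apply]
  rw [h]
  exact (posSemidef_vecMulVec_self_star _).smul ha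

theorem cos_sub {ι : Type*} [Finite ι] (x : ι → ℝ) :
    (Matrix.of fun i j => Real.cos (x i - x j)).PosSemidef := by
  have h : (Matrix.of fun i j => Real.cos (x i - x j)) =
      vecMulVec (fun i => Real.cos (x i)) (star fun i => Real.cos (x i)) +
        vecMulVec (fun i => Real.sin (x i)) (star fun i => Real.sin (x i)) := by
    ext i j
    simp [vecMulVec_apply, Real.cos_sub]
  rw [h]
  exact (posSemidef_vecMulVec_self_star _).add (posSemidef_vecMulVec_self_star _)

end Matrix.PosSemidef

theorem integrableOn_exp_neg_mul_cos (s : ℝ) :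
    IntegrableOn (fun t : ℝ => Real.exp (-t) * Real.cos (s * t)) (Set.Ioi 0) := by
  have h := (integrableOn_exp_mul_complex_Ioi (a := -1 + s * Complex.I) (by simp) 0).re
  refine h.congr (.of_forall fun t => ?_)
  simp [Complex.exp_re]

theorem integral_exp_neg_mul_cos (s : ℝ) :
    ∫ t : ℝ in Set.Ioi 0, Real.exp (-t) * Real.cos (s * t) = 1 / (1 + s ^ 2) := by
  have ha : (-1 + s * Complex.I : ℂ).re < 0 := by simp
  have h := congrArg Complex.re (integral_exp_mul_complex_Ioi ha 0)
  rw [← RCLike.re_to_complex, ← integral_re (integrableOn_exp_mul_complex_Ioi ha 0)] at h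
  simp only [RCLike.re_to_complex, Complex.exp_re] at h
  simpa [Complex.div_re, Complex.normSq_apply, ← sq] using h

theorem Matrix.PosSemidef.one_div_one_add_sub_sq {ι : Type*} [Finite ι] (x : ι → ℝ) :
    (Matrix.of fun i j => 1 / (1 + (x i - x j) ^ 2)).PosSemidef := by
  simp_rw [← integral_exp_neg_mul_cos]
  refine Matrix.PosSemidef.of_integral
    (A := fun t => Matrix.of fun i j => Real.exp (-t) * Real.cos ((x i - x j) * t))
    (fun t => ?_) fun i j => integrableOn_exp_neg_mul_cos _
  convert (Matrix.PosSemidef.cos_sub fun i => x i * t).smul (Real.exp_pos (-t)).le using 1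
  ext i j
  simp [sub_mul]

theorem Matrix.PosSemidef.one_add_sq_div_one_add_sq {ι : Type*} [Finite ι] {a b : ℝ} (hb : b ≠ 0)
    (hab : a ^ 2 ≤ b ^ 2) (x : ι → ℝ) :
    (Matrix.of fun i j =>
      (1 + (a * (x i - x j)) ^ 2) / (1 + (b * (x i - x j)) ^ 2)).PosSemidef := by
  have hb2 : 0 < b ^ 2 := by positivity
  have h := (Matrix.PosSemidef.of_const (ι := ι) (a := a ^ 2 / b ^ 2) (by positivity)).add
    ((Matrix.PosSemidef.one_div_one_add_sub_sq fun i => b * x i).smul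
      (sub_nonneg.2 ((div_le_one hb2).2 hab)))
  convert h using 1
  ext i j
  have h1 : 1 + (b * (x i - x j)) ^ 2 ≠ 0 := by positivity
  simp only [Matrix.of_apply, Matrix.add_apply, Matrix.smul_apply, smul_eq_mul, ← mul_sub]
  field_simp
  ring

theorem Matrix.PosSemidef.of_prod {ι κ : Type*} [Finite ι] (s : Finset κ) {A : κ → Matrix ι ι ℝ}
    (hA : ∀ k ∈ s, (A k).PosSemidef) :
    (Matrix.of fun i j => ∏ k ∈ s, A k i j).PosSemidef := by
  induction s using Finset.cons_induction with
  | empty => simpa using Matrix.PosSemidef.of_const (ι := ι) zero_le_one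
  | cons k s hk ih =>
    simp only [Finset.prod_cons]
    exact (hA k (by simp)).hadamard (ih fun m hm => hA m (by simp [hm]))

/-- Euler's infinite product for the hyperbolic sine. -/
theorem Real.tendsto_euler_sinh_prod (x : ℝ) :
    Tendsto (fun n : ℕ => x * ∏ k ∈ Finset.range n, (1 + (x / (Real.pi * (k + 1))) ^ 2))
      atTop (𝓝 (Real.sinh x)) := by
  have hpi : (Real.pi : ℂ) ≠ 0 := by exact_mod_cast Real.pi_ne_zero
  have h := (Complex.continuous_im.tendsto _).comp
    (Complex.tendsto_euler_sin_prod (x * Complex.I / Real.pi))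
  have hsin : Complex.sin (Real.pi * (x * Complex.I / Real.pi)) =
      (Real.sinh x : ℝ) * Complex.I := by
    rw [mul_div_cancel₀ _ hpi, Complex.sin_mul_I, Complex.ofReal_sinh]
  rw [hsin, Complex.im_ofReal_mul, Complex.I_im, mul_one] at h
  refine h.congr fun n => ?_
  have hprod : (Real.pi * (x * Complex.I / Real.pi) *
      ∏ k ∈ Finset.range n, (1 - (x * Complex.I / Real.pi) ^ 2 / ((k : ℂ) + 1) ^ 2) : ℂ) =
      ((x * ∏ k ∈ Finset.range n, (1 + (x / (Real.pi * (k + 1))) ^ 2) : ℝ) : ℂ) * Complex.I := by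
    rw [mul_div_cancel₀ _ hpi]
    push_cast
    rw [mul_right_comm]
    congr 2
    refine Finset.prod_congr rfl fun k _ => ?_
    rw [div_pow, mul_pow, Complex.I_sq, div_pow, mul_pow, div_div]
    ring
  rw [Function.comp_apply, hprod, Complex.im_ofReal_mul, Complex.I_im, mul_one]

theorem Real.tendsto_euler_sinh_quotient_prod (α : ℝ) {β y : ℝ} (hβ : β ≠ 0) :
    Tendsto (fun n : ℕ => α / β * ∏ k ∈ Finset.range n,
      ((1 + (α / (Real.pi * (k + 1)) * y) ^ 2) / (1 + (β / (Real.pi * (k + 1)) * y) ^ 2)))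
      atTop (𝓝 (if y = 0 then α / β else Real.sinh (α * y) / Real.sinh (β * y))) := by
  split_ifs with hy
  · simp [hy]
  · refine ((Real.tendsto_euler_sinh_prod (α * y)).div (Real.tendsto_euler_sinh_prod (β * y))
      (by simp [hβ, hy])).congr fun n => ?_
    simp only [Pi.div_apply]
    rw [Finset.prod_div_distrib, mul_div_mul_comm, mul_div_mul_right _ _ hy]
    simp_rw [div_mul_eq_mul_div]

/-- Lemma 2.1(ii): `x ↦ sinh(αx)/sinh(βx)` (with value `α/β` at `x = 0`) is positive
definite when `|β| > |α| > 0` and `α, β` have the same sign. -/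
theorem sinh_quotient_posDef (α β : ℝ) (hα : 0 < |α|) (hαβ : |α| < |β|)
    (hsign : 0 < α * β) (n : ℕ) (x : Fin n → ℝ) :
    (Matrix.of fun i j : Fin n =>
      if x i - x j = 0 then α / β
      else Real.sinh (α * (x i - x j)) / Real.sinh (β * (x i - x j))).PosSemidef := by
  have hβ : β ≠ 0 := abs_pos.1 (hα.trans hαβ)
  have hquot : 0 ≤ α / β := by
    rw [← mul_div_mul_right α β hβ]
    exact div_nonneg hsign.le (mul_self_nonneg β)
  refine Matrix.PosSemidef.of_tendsto (l := atTop) (fun N => ?_) fun i j =>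
    Real.tendsto_euler_sinh_quotient_prod α hβ
  refine (Matrix.PosSemidef.of_prod (Finset.range N) fun k _ =>
    Matrix.PosSemidef.one_add_sq_div_one_add_sq (a := α / (Real.pi * (k + 1)))
      (b := β / (Real.pi * (k + 1))) ?_ ?_ x).smul hquot
  · have := Real.pi_pos
    positivity
  · rw [div_pow, div_pow]
    gcongr ?_ / _
    exact sq_le_sq.2 hαβ.le
end

section
/- Let s, t be real numbers in [0,1] with |1 − 2t| < |1 − 2s|. Then the Heinz mean H_t strongly dominates the Heinz mean H_s: for every positive integer n and all positive real numbers λ₁, …, λₙ, the n×n matrix with (i,j) entry H_t(λᵢ, λⱼ)/H_s(λᵢ, λⱼ) is positive semidefinite. (Theorem 2.2(ii)) -/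
/-- The Heinz mean `H_t(a,b) = (a^{1-t} b^t + a^t b^{1-t}) / 2`. -/
noncomputable def heinzMean (t a b : ℝ) : ℝ :=
  (a ^ (1 - t) * b ^ t + a ^ t * b ^ (1 - t)) / 2

open MeasureTheory Set

section PosSemidef

variable {ι : Type*}

/-- An entrywise integral of positive semidefinite real matrices is positive semidefinite. -/
theorem Matrix.posSemidef_integral [Finite ι] {α : Type*} [MeasurableSpace α] {μ : Measure α}
    {F : α → Matrix ι ι ℝ} (hint : ∀ i j, Integrable (fun z => F z i j) μ)
    (hF : ∀ᵐ z ∂μ, (F z).PosSemidef) :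
    (Matrix.of fun i j => ∫ z, F z i j ∂μ).PosSemidef := by
  have := Fintype.ofFinite ι
  refine .of_dotProduct_mulVec_nonneg (Matrix.IsHermitian.ext fun i j => ?_) fun c => ?_
  · refine integral_congr_ae ?_
    filter_upwards [hF] with z hz
    exact hz.isHermitian.apply i j
  · have key : star c ⬝ᵥ ((Matrix.of fun i j => ∫ z, F z i j ∂μ).mulVec c)
        = ∫ z, star c ⬝ᵥ ((F z).mulVec c) ∂μ := by
      simp only [dotProduct, Matrix.mulVec, Matrix.of_apply]
      rw [integral_finsetSum]
      · refine Finset.sum_congr rfl fun i _ => ?_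
        rw [integral_const_mul, integral_finsetSum]
        · simp only [integral_mul_const]
        · exact fun j _ => (hint i j).mul_const _
      · exact fun i _ => (integrable_finsetSum _ fun j _ => (hint i j).mul_const _).const_mul _
    rw [key]
    refine integral_nonneg_of_ae ?_
    filter_upwards [hF] with z hz
    exact hz.dotProduct_mulVec_nonneg c

theorem Matrix.posSemidef_of_mul_self [Finite ι] (d : ι → ℝ) :
    (Matrix.of fun i j => d i * d j).PosSemidef :=
  Matrix.posSemidef_vecMulVec_self_star d

/-- Congruence by a real diagonal matrix, entrywise. -/
theorem Matrix.PosSemidef.diag_congr [Finite ι] {M : Matrix ι ι ℝ} (hM : M.PosSemidef)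
    (d : ι → ℝ) : (Matrix.of fun i j => d i * d j * M i j).PosSemidef :=
  (Matrix.posSemidef_of_mul_self d).hadamard hM

/-- Cauchy matrices with positive nodes are positive semidefinite. -/
theorem Matrix.posSemidef_cauchy [Finite ι] {x : ι → ℝ} (hx : ∀ i, 0 < x i) :
    (Matrix.of fun i j => (x i + x j)⁻¹).PosSemidef := by
  have hneg : ∀ i j, -(x i + x j) < 0 := fun i j => neg_lt_zero.2 (add_pos (hx i) (hx j))
  have h := Matrix.posSemidef_integral (μ := volume.restrict (Ioi (0 : ℝ)))
    (F := fun z => Matrix.of fun i j => Real.exp (-(x i + x j) * z))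
    (fun i j => integrableOn_exp_mul_Ioi (hneg i j) 0) (.of_forall fun z => ?_)
  · convert h using 4 with i j
    simp only [Matrix.of_apply]
    rw [integral_exp_mul_Ioi (hneg i j)]
    rw [mul_zero, Real.exp_zero, neg_div_neg_eq, one_div]
  · convert Matrix.posSemidef_of_mul_self fun i => Real.exp (-(x i) * z) using 4 with i j
    rw [← Real.exp_add]
    ring_nf

/-- The Kwong matrix of the resolvent-type function `u ↦ u / (c + u)` is positive semidefinite. -/
theorem Matrix.posSemidef_kwong_resolvent [Finite ι] {x : ι → ℝ} (hx : ∀ i, 0 < x i) {c : ℝ}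
    (hc : 0 ≤ c) :
    (Matrix.of fun i j => (x i / (c + x i) + x j / (c + x j)) / (x i + x j)).PosSemidef := by
  have h := (((Matrix.posSemidef_cauchy hx).diag_congr fun i => x i / (c + x i)).smul
    (zero_le_two (α := ℝ))).add
    ((Matrix.posSemidef_of_mul_self fun i => (c + x i)⁻¹).smul hc)
  convert h using 1
  ext i j
  have hi := hx i
  have hj := hx j
  simp only [Matrix.of_apply, Matrix.add_apply, Matrix.smul_apply, smul_eq_mul]
  field_simp
  ring

/-- The Kwong matrix of `u ↦ u ^ p` with `0 ≤ p < 1` is positive semidefinite. -/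
theorem Matrix.posSemidef_kwong_rpow [Finite ι] {x : ι → ℝ} (hx : ∀ i, 0 < x i) {p : ℝ}
    (hp0 : 0 ≤ p) (hp1 : p < 1) :
    (Matrix.of fun i j => (x i ^ p + x j ^ p) / (x i + x j)).PosSemidef := by
  rcases hp0.eq_or_lt with rfl | hp0
  · convert (Matrix.posSemidef_cauchy hx).smul (zero_le_two (α := ℝ)) using 1
    ext i j
    simp [one_add_one_eq_two, div_eq_mul_inv]
  have hp : p ∈ Ioo (0 : ℝ) 1 := ⟨hp0, hp1⟩
  have hint : ∀ i, Integrable (fun z => Real.rpowIntegrand₀₁ p z (x i))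
      (volume.restrict (Ioi 0)) := fun i =>
    Real.integrableOn_rpowIntegrand₀₁_Ioi hp (hx i).le
  have h := (Matrix.posSemidef_integral (μ := volume.restrict (Ioi (0 : ℝ)))
    (F := fun z => Matrix.of fun i j =>
      (Real.rpowIntegrand₀₁ p z (x i) + Real.rpowIntegrand₀₁ p z (x j)) / (x i + x j))
    (fun i j => ((hint i).add (hint j)).div_const _) ?_).smul
    (inv_nonneg.2 (Real.integral_rpowIntegrand₀₁_one_pos hp).le)
  · convert h using 1
    ext i j
    simp only [Matrix.of_apply, Matrix.smul_apply, smul_eq_mul]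
    rw [integral_div, integral_add (hint i) (hint j),
      Real.rpow_eq_const_mul_integral hp (hx i).le, Real.rpow_eq_const_mul_integral hp (hx j).le]
    ring
  · filter_upwards [ae_restrict_mem measurableSet_Ioi] with z hz
    have hz : 0 < z := hz
    convert (Matrix.posSemidef_kwong_resolvent hx hz.le).smul
      (Real.rpow_nonneg hz.le (p - 1)) using 1
    ext i j
    simp only [Matrix.of_apply, Matrix.smul_apply, smul_eq_mul]
    rw [Real.rpowIntegrand₀₁_eq_pow_div hp hz.le (hx i).le,
      Real.rpowIntegrand₀₁_eq_pow_div hp hz.le (hx j).le]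
    ring

end PosSemidef

theorem heinzMean_one_sub (t a b : ℝ) : heinzMean (1 - t) a b = heinzMean t a b := by
  unfold heinzMean
  rw [sub_sub_cancel, add_comm]

theorem heinzMean_eq_mul_add (t : ℝ) {a b : ℝ} (ha : 0 < a) (hb : 0 < b) :
    heinzMean t a b = a ^ t * b ^ t * (a ^ (1 - 2 * t) + b ^ (1 - 2 * t)) / 2 := by
  have h : 1 - t = t + (1 - 2 * t) := by ring
  rw [heinzMean, h, Real.rpow_add ha, Real.rpow_add hb]
  ring

theorem posSemidef_heinzMean_div_heinzMean {ι : Type*} [Finite ι] {s t : ℝ} (hst : s < t)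
    (ht : t ≤ 1 / 2) {x : ι → ℝ} (hx : ∀ i, 0 < x i) :
    (Matrix.of fun i j => heinzMean t (x i) (x j) / heinzMean s (x i) (x j)).PosSemidef := by
  have hs : 0 < 1 - 2 * s := by linarith
  have h := (Matrix.posSemidef_kwong_rpow (fun i => Real.rpow_pos_of_pos (hx i) (1 - 2 * s))
    (div_nonneg (by linarith) hs.le : 0 ≤ (1 - 2 * t) / (1 - 2 * s))
    ((div_lt_one hs).2 (by linarith))).diag_congr fun i => x i ^ t / x i ^ s
  convert h using 1
  ext i j
  have hi := hx i
  have hj := hx j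
  simp only [Matrix.of_apply]
  rw [heinzMean_eq_mul_add t hi hj, heinzMean_eq_mul_add s hi hj, ← Real.rpow_mul hi.le,
    ← Real.rpow_mul hj.le, mul_div_cancel₀ _ hs.ne']
  have := Real.rpow_pos_of_pos hi s
  have := Real.rpow_pos_of_pos hj s
  have := Real.rpow_pos_of_pos hi (1 - 2 * s)
  have := Real.rpow_pos_of_pos hj (1 - 2 * s)
  field_simp

/-- Every Heinz mean is one whose parameter is at most `1 / 2`. -/
theorem exists_heinzMean_eq (t : ℝ) :
    ∃ r ≤ 1 / 2, 1 - 2 * r = |1 - 2 * t| ∧ heinzMean r = heinzMean t := by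
  rcases le_total t (1 / 2) with h | h
  · exact ⟨t, h, (abs_of_nonneg (by linarith)).symm, rfl⟩
  · refine ⟨1 - t, by linarith, ?_, ?_⟩
    · rw [abs_of_nonpos (by linarith)]
      ring
    · ext a b
      exact heinzMean_one_sub t a b

/-- Theorem 2.2(ii): if `s, t ∈ [0,1]` and `|1 - 2t| < |1 - 2s|`, then the Heinz mean `H_t`
strongly dominates the Heinz mean `H_s`. -/
theorem heinz_strongly_dominates_heinz (s t : ℝ) (hs0 : 0 ≤ s) (hs1 : s ≤ 1)
    (ht0 : 0 ≤ t) (ht1 : t ≤ 1) (hts : |1 - 2 * t| < |1 - 2 * s|)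
    (n : ℕ) (lam : Fin n → ℝ) (hlam : ∀ i, 0 < lam i) :
    (Matrix.of fun i j : Fin n =>
      heinzMean t (lam i) (lam j) / heinzMean s (lam i) (lam j)).PosSemidef := by
  obtain ⟨s', -, hs', hs⟩ := exists_heinzMean_eq s
  obtain ⟨t', ht', hte, ht⟩ := exists_heinzMean_eq t
  rw [← hs, ← ht]
  exact posSemidef_heinzMean_div_heinzMean (by linarith) ht' hlam
end

section
/- Let A and B be n×n positive semidefinite complex matrices, X an arbitrary n×n complex matrix, and let s, t be real numbers with 0 ≤ s < 1/2 and |1 − 2t| < (1 − 2s)/2. Then ‖A^{1−t}XB^t + A^tXB^{1−t}‖_F ≤ (2/(1−2s)) ‖∫_s^{1−s} A^v X B^{1−v} dv‖_F, where ‖·‖_F denotes the Frobenius norm. (Theorem 2.3, instance for the Frobenius norm) -/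
open scoped ComplexOrder

/-- Matrix power of a positive semidefinite matrix via the continuous functional calculus
(equivalently, raising each eigenvalue to the power `v` in a spectral decomposition). -/
noncomputable def mpow {n : ℕ} (A : Matrix (Fin n) (Fin n) ℂ) (v : ℝ) :
    Matrix (Fin n) (Fin n) ℂ :=
  cfc (fun x : ℝ => x ^ v) A

/-- The Frobenius norm of a complex matrix. -/
noncomputable def frobNorm {n : ℕ} (M : Matrix (Fin n) (Fin n) ℂ) : ℝ :=
  Real.sqrt (∑ i, ∑ j, ‖M i j‖ ^ 2)

/-- The operator norm of a complex matrix induced by the Euclidean norm on `ℂⁿ`. -/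
noncomputable def l2OpNorm {n : ℕ} (M : Matrix (Fin n) (Fin n) ℂ) : ℝ :=
  ‖Matrix.toEuclideanCLM (𝕜 := ℂ) M‖

/-- The entrywise integral `∫ A^v X B^{1-v} dv` over `[s, 1-s]`. -/
noncomputable def mInt {n : ℕ} (A B X : Matrix (Fin n) (Fin n) ℂ) (s : ℝ) :
    Matrix (Fin n) (Fin n) ℂ :=
  Matrix.of fun i j => ∫ v in s..(1 - s), (mpow A v * X * mpow B (1 - v)) i j

theorem mpow_eq_conj_diagonal {n : ℕ} {A : Matrix (Fin n) (Fin n) ℂ} (hA : A.IsHermitian)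
    (v : ℝ) :
    mpow A v = (hA.eigenvectorUnitary : Matrix (Fin n) (Fin n) ℂ) *
      Matrix.diagonal (fun i => ((hA.eigenvalues i ^ v : ℝ) : ℂ)) *
      star (hA.eigenvectorUnitary : Matrix (Fin n) (Fin n) ℂ) := by
  rw [mpow, hA.cfc_eq, Matrix.IsHermitian.cfc, Unitary.conjStarAlgAut_apply]
  rfl

theorem frobNorm_eq_sqrt_trace {n : ℕ} (M : Matrix (Fin n) (Fin n) ℂ) :
    frobNorm M = √(star M * M).trace.re := by
  rw [frobNorm, Finset.sum_comm]
  congr 1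
  simp [Matrix.trace, Matrix.mul_apply, Matrix.star_apply, ← Complex.normSq_eq_conj_mul_self,
    Complex.normSq_eq_norm_sq, -Complex.ofReal_pow]

theorem frobNorm_unitary_conj {n : ℕ} (U V : Matrix.unitaryGroup (Fin n) ℂ)
    (M : Matrix (Fin n) (Fin n) ℂ) :
    frobNorm ((U : Matrix (Fin n) (Fin n) ℂ) * M * star (V : Matrix (Fin n) (Fin n) ℂ)) =
      frobNorm M := by
  have hU : star (U : Matrix (Fin n) (Fin n) ℂ) * U = 1 := Unitary.coe_star_mul_self U
  have hV : star (V : Matrix (Fin n) (Fin n) ℂ) * V = 1 := Unitary.coe_star_mul_self V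
  rw [frobNorm_eq_sqrt_trace, frobNorm_eq_sqrt_trace]
  have h : star ((U : Matrix (Fin n) (Fin n) ℂ) * M * star (V : Matrix (Fin n) (Fin n) ℂ)) *
      (U * M * star (V : Matrix (Fin n) (Fin n) ℂ)) =
      V * (star M * (star (U : Matrix (Fin n) (Fin n) ℂ) * U) * M) *
        star (V : Matrix (Fin n) (Fin n) ℂ) := by
    simp only [star_mul, star_star, mul_assoc]
  rw [h, hU, mul_one, Matrix.trace_mul_comm, ← mul_assoc, hV, one_mul]

theorem frobNorm_le_mul {n : ℕ} {M N : Matrix (Fin n) (Fin n) ℂ} {c : ℝ} (hc : 0 ≤ c)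
    (h : ∀ i j, ‖M i j‖ ≤ c * ‖N i j‖) : frobNorm M ≤ c * frobNorm N := by
  rw [frobNorm, frobNorm]
  apply Real.sqrt_le_iff.2
  refine ⟨by positivity, ?_⟩
  rw [mul_pow, Real.sq_sqrt (by positivity), Finset.mul_sum]
  refine Finset.sum_le_sum fun i _ => ?_
  rw [Finset.mul_sum]
  refine Finset.sum_le_sum fun j _ => ?_
  rw [← mul_pow]
  gcongr
  exact h i j

/-- The geometric-mean path `v ↦ a ^ v * b ^ (1 - v)` is integrable inside `[0, 1]`, including
when a base vanishes. -/
theorem intervalIntegrable_rpow_mul_rpow {a b : ℝ} (ha : 0 ≤ a) (hb : 0 ≤ b) {s : ℝ}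
    (hs0 : 0 ≤ s) (hs : s ≤ 1 / 2) :
    IntervalIntegrable (fun v => a ^ v * b ^ (1 - v)) MeasureTheory.volume s (1 - s) := by
  have hle : s ≤ 1 - s := by linarith
  by_cases h : 0 < a ∧ 0 < b
  · obtain ⟨ha, hb⟩ := h
    apply Continuous.intervalIntegrable
    exact (continuous_const.rpow continuous_id fun _ => Or.inl ha.ne').mul
      (continuous_const.rpow (continuous_const.sub continuous_id) fun _ => Or.inl hb.ne')
  · refine (IntervalIntegrable.zero (E := ℝ)).congr_uIoo ?_
    rw [Set.uIoo_of_le hle]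
    rintro v ⟨h1, h2⟩
    rcases ha.eq_or_lt with rfl | ha
    · simp [Real.zero_rpow (show v ≠ 0 by linarith)]
    · rcases hb.eq_or_lt with rfl | hb
      · simp [Real.zero_rpow (show 1 - v ≠ 0 by linarith)]
      · exact absurd ⟨ha, hb⟩ h

theorem cosh_half_mul_le_sinh {u : ℝ} (hu : 0 ≤ u) : Real.cosh (u / 2) * u ≤ Real.sinh u := by
  have h1 : u / 2 ≤ Real.sinh (u / 2) := Real.self_le_sinh_iff.2 (by linarith)
  have h2 : Real.sinh u = 2 * Real.sinh (u / 2) * Real.cosh (u / 2) := by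
    rw [← Real.sinh_two_mul]; ring_nf
  rw [h2]
  nlinarith [Real.cosh_pos (u / 2)]

theorem cosh_mul_le_sinh_div {c e d : ℝ} (hc : 0 < c) (he : |e| ≤ c / 2) (hd : d ≠ 0) :
    Real.cosh (e * d) ≤ Real.sinh (c * d) / (c * d) := by
  have h0 : 0 < c * |d| := by positivity
  have h1 : Real.cosh (e * d) ≤ Real.cosh (c * |d| / 2) := by
    rw [Real.cosh_le_cosh, abs_mul, abs_of_nonneg (by positivity : 0 ≤ c * |d| / 2)]
    nlinarith [abs_nonneg d]
  have h2 : Real.sinh (c * d) / (c * d) = Real.sinh (c * |d|) / (c * |d|) := by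
    rcases abs_cases d with ⟨h, _⟩ | ⟨h, _⟩ <;> rw [h]
    rw [mul_neg, Real.sinh_neg, neg_div_neg_eq]
  rw [h2, le_div_iff₀ h0]
  exact (mul_le_mul_of_nonneg_right h1 h0.le).trans (cosh_half_mul_le_sinh h0.le)

theorem integral_exp_add_mul (m d s : ℝ) (hd : d ≠ 0) :
    ∫ v in s..(1 - s), Real.exp (m + (2 * v - 1) * d) =
      Real.exp m * (Real.sinh ((1 - 2 * s) * d) / d) := by
  have hderiv : ∀ v ∈ Set.uIcc s (1 - s), HasDerivAt
      (fun v => Real.exp (m + (2 * v - 1) * d) / (2 * d)) (Real.exp (m + (2 * v - 1) * d)) v := by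
    intro v _
    have h := ((((((hasDerivAt_id v).const_mul 2).sub_const 1).mul_const d).const_add
      m).exp).div_const (2 * d)
    refine h.congr_deriv ?_
    simp only [id]
    field_simp
  rw [intervalIntegral.integral_eq_sub_of_hasDerivAt hderiv
    (Continuous.intervalIntegrable (by fun_prop) _ _), Real.sinh_eq, Real.exp_add, Real.exp_add]
  rw [show (2 * (1 - s) - 1) * d = (1 - 2 * s) * d by ring,
    show (2 * s - 1) * d = -((1 - 2 * s) * d) by ring]
  field_simp

/-- The scalar inequality between the Heinz mean and the average of the geometric-mean path. -/
theorem rpow_heinz_le_integral {a b s t : ℝ} (ha : 0 ≤ a) (hb : 0 ≤ b) (hs0 : 0 ≤ s)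
    (hs : s < 1 / 2) (ht : |1 - 2 * t| < (1 - 2 * s) / 2) :
    a ^ (1 - t) * b ^ t + a ^ t * b ^ (1 - t) ≤
      2 / (1 - 2 * s) * ∫ v in s..(1 - s), a ^ v * b ^ (1 - v) := by
  have hc : 0 < 1 - 2 * s := by linarith
  by_cases h : 0 < a ∧ 0 < b
  · obtain ⟨ha, hb⟩ := h
    set d := (Real.log a - Real.log b) / 2 with hd
    set m := (Real.log a + Real.log b) / 2 with hm
    have key : ∀ v w : ℝ, v + w = 1 → a ^ v * b ^ w = Real.exp (m + (2 * v - 1) * d) := by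
      intro v w hvw
      obtain rfl : w = 1 - v := by linarith
      rw [Real.rpow_def_of_pos ha, Real.rpow_def_of_pos hb, ← Real.exp_add]
      congr 1
      rw [hd, hm]
      ring
    have hint : ∫ v in s..(1 - s), a ^ v * b ^ (1 - v) =
        ∫ v in s..(1 - s), Real.exp (m + (2 * v - 1) * d) := by
      simp_rw [fun v : ℝ => key v (1 - v) (by ring)]
    have hL : a ^ (1 - t) * b ^ t + a ^ t * b ^ (1 - t) =
        2 * (Real.exp m * Real.cosh ((1 - 2 * t) * d)) := by
      rw [key _ _ (by ring), key _ _ (by ring), Real.exp_add, Real.exp_add, Real.cosh_eq,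
        show (2 * (1 - t) - 1) * d = (1 - 2 * t) * d by ring,
        show (2 * t - 1) * d = -((1 - 2 * t) * d) by ring]
      ring
    rw [hint, hL]
    by_cases hd0 : d = 0
    · rw [hd0]
      simp only [mul_zero, add_zero, Real.cosh_zero, mul_one, intervalIntegral.integral_const,
        smul_eq_mul]
      apply le_of_eq
      field_simp
      ring
    · rw [integral_exp_add_mul m d s hd0]
      calc 2 * (Real.exp m * Real.cosh ((1 - 2 * t) * d))
          ≤ 2 * (Real.exp m * (Real.sinh ((1 - 2 * s) * d) / ((1 - 2 * s) * d))) := by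
            gcongr
            exact cosh_mul_le_sinh_div hc ht.le hd0
        _ = _ := by field_simp
  · have ht' := abs_lt.1 ht
    have hL : a ^ (1 - t) * b ^ t + a ^ t * b ^ (1 - t) = 0 := by
      have h1 : t ≠ 0 := by intro h; linarith
      have h2 : 1 - t ≠ 0 := by intro h; linarith
      rcases ha.eq_or_lt with rfl | ha
      · simp [Real.zero_rpow h1, Real.zero_rpow h2]
      · rcases hb.eq_or_lt with rfl | hb
        · simp [Real.zero_rpow h1, Real.zero_rpow h2]
        · exact absurd ⟨ha, hb⟩ h
    rw [hL]
    exact mul_nonneg (by positivity)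
      (intervalIntegral.integral_nonneg (by linarith) fun v _ => by positivity)

theorem mpow_mul_mul_mpow {n : ℕ} {A B : Matrix (Fin n) (Fin n) ℂ} (hA : A.IsHermitian)
    (hB : B.IsHermitian) (X : Matrix (Fin n) (Fin n) ℂ) (v w : ℝ) :
    mpow A v * X * mpow B w = (hA.eigenvectorUnitary : Matrix (Fin n) (Fin n) ℂ) *
      (Matrix.of fun i j => ((hA.eigenvalues i ^ v * hB.eigenvalues j ^ w : ℝ) : ℂ) *
        (star (hA.eigenvectorUnitary : Matrix (Fin n) (Fin n) ℂ) * X *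
          hB.eigenvectorUnitary) i j) *
      star (hB.eigenvectorUnitary : Matrix (Fin n) (Fin n) ℂ) := by
  set U := (hA.eigenvectorUnitary : Matrix (Fin n) (Fin n) ℂ)
  set V := (hB.eigenvectorUnitary : Matrix (Fin n) (Fin n) ℂ)
  have h : (Matrix.of fun i j => ((hA.eigenvalues i ^ v * hB.eigenvalues j ^ w : ℝ) : ℂ) *
        (star U * X * V) i j) =
      Matrix.diagonal (fun i => ((hA.eigenvalues i ^ v : ℝ) : ℂ)) * (star U * X * V) *
        Matrix.diagonal (fun i => ((hB.eigenvalues i ^ w : ℝ) : ℂ)) := by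
    ext i j
    rw [Matrix.mul_diagonal, Matrix.diagonal_mul, Matrix.of_apply]
    push_cast
    ring
  rw [h, mpow_eq_conj_diagonal hA, mpow_eq_conj_diagonal hB]
  simp only [mul_assoc, U, V]

theorem mInt_eq {n : ℕ} {A B : Matrix (Fin n) (Fin n) ℂ} (hA : A.PosSemidef)
    (hB : B.PosSemidef) (X : Matrix (Fin n) (Fin n) ℂ) {s : ℝ} (hs0 : 0 ≤ s) (hs : s ≤ 1 / 2) :
    mInt A B X s = (hA.1.eigenvectorUnitary : Matrix (Fin n) (Fin n) ℂ) *
      (Matrix.of fun i j => ((∫ v in s..(1 - s),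
          hA.1.eigenvalues i ^ v * hB.1.eigenvalues j ^ (1 - v) : ℝ) : ℂ) *
        (star (hA.1.eigenvectorUnitary : Matrix (Fin n) (Fin n) ℂ) * X *
          hB.1.eigenvectorUnitary) i j) *
      star (hB.1.eigenvectorUnitary : Matrix (Fin n) (Fin n) ℂ) := by
  ext i j
  rw [mInt, Matrix.of_apply]
  simp_rw [mpow_mul_mul_mpow hA.1 hB.1 X]
  simp only [Matrix.mul_apply (M := _ * _) (N := star _), Matrix.mul_apply (N := Matrix.of _),
    Matrix.of_apply]
  have hI : ∀ k l, IntervalIntegrable (fun v => ((hA.1.eigenvalues k ^ v *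
      hB.1.eigenvalues l ^ (1 - v) : ℝ) : ℂ)) MeasureTheory.volume s (1 - s) := fun k l =>
    have h := intervalIntegrable_rpow_mul_rpow (hA.eigenvalues_nonneg k)
      (hB.eigenvalues_nonneg l) hs0 hs
    ⟨h.1.ofReal, h.2.ofReal⟩
  have hJ : ∀ l k, IntervalIntegrable (fun v =>
      (hA.1.eigenvectorUnitary : Matrix (Fin n) (Fin n) ℂ) i k *
      (((hA.1.eigenvalues k ^ v * hB.1.eigenvalues l ^ (1 - v) : ℝ) : ℂ) *
        (star (hA.1.eigenvectorUnitary : Matrix (Fin n) (Fin n) ℂ) * X *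
          hB.1.eigenvectorUnitary) k l)) MeasureTheory.volume s (1 - s) := fun l k =>
    ((hI k l).mul_const _).const_mul _
  have hK : ∀ l, IntervalIntegrable (fun v => ∑ k,
      (hA.1.eigenvectorUnitary : Matrix (Fin n) (Fin n) ℂ) i k *
      (((hA.1.eigenvalues k ^ v * hB.1.eigenvalues l ^ (1 - v) : ℝ) : ℂ) *
        (star (hA.1.eigenvectorUnitary : Matrix (Fin n) (Fin n) ℂ) * X *
          hB.1.eigenvectorUnitary) k l)) MeasureTheory.volume s (1 - s) := fun l => by
    simpa only [Finset.sum_fn] using IntervalIntegrable.sum Finset.univ fun k _ => hJ l k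
  rw [intervalIntegral.integral_finsetSum fun l _ => (hK l).mul_const _]
  refine Finset.sum_congr rfl fun l _ => ?_
  rw [intervalIntegral.integral_mul_const, intervalIntegral.integral_finsetSum fun k _ => hJ l k]
  congr 1
  refine Finset.sum_congr rfl fun k _ => ?_
  rw [intervalIntegral.integral_const_mul, intervalIntegral.integral_mul_const,
    intervalIntegral.integral_ofReal]

/-- Theorem 2.3 for the Frobenius norm. -/
theorem heinz_le_genLog_frobenius (n : ℕ) (A B X : Matrix (Fin n) (Fin n) ℂ)
    (hA : A.PosSemidef) (hB : B.PosSemidef) (s t : ℝ) (hs0 : 0 ≤ s) (hs : s < 1 / 2)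
    (ht : |1 - 2 * t| < (1 - 2 * s) / 2) :
    frobNorm (mpow A (1 - t) * X * mpow B t + mpow A t * X * mpow B (1 - t)) ≤
      (2 / (1 - 2 * s)) * frobNorm (mInt A B X s) := by
  have hc : 0 < 1 - 2 * s := by linarith
  rw [mInt_eq hA hB X hs0 hs.le, mpow_mul_mul_mpow hA.1 hB.1, mpow_mul_mul_mpow hA.1 hB.1,
    ← add_mul, ← mul_add, frobNorm_unitary_conj, frobNorm_unitary_conj]
  refine frobNorm_le_mul (by positivity) fun i j => ?_
  have ha := hA.eigenvalues_nonneg i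
  have hb := hB.eigenvalues_nonneg j
  rw [Matrix.add_apply, Matrix.of_apply, Matrix.of_apply, Matrix.of_apply, ← add_mul,
    ← Complex.ofReal_add, norm_mul, norm_mul, Complex.norm_of_nonneg (by positivity),
    Complex.norm_of_nonneg (intervalIntegral.integral_nonneg (by linarith)
      fun v _ => by positivity), ← mul_assoc]
  gcongr
  exact rpow_heinz_le_integral ha hb hs0 hs ht
end

section
/- Let A and B be n×n positive semidefinite complex matrices, X an arbitrary n×n complex matrix, and let s be a real number with 0 ≤ s < 1/2. Then ‖∫_s^{1−s} A^v X B^{1−v} dv‖ ≤ ((1−2s)/2) ‖A^{1−s}XB^s + A^sXB^{1−s}‖, where ‖·‖ denotes the operator norm induced by the Euclidean norm on ℂⁿ. (Theorem 2.4, instance for the operator norm) -/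
open scoped ComplexOrder

section AMGM

variable {E : Type*} [NormedAddCommGroup E] [InnerProductSpace ℂ E] [FiniteDimensional ℂ E]

/-- In finite dimension an operator attains its norm at a unit vector, which is then a
right singular vector for the largest singular value. -/
lemma exists_unit_adjoint_apply_apply [CompleteSpace E] [Nontrivial E] (M : E →L[ℂ] E) :
    ∃ x : E, ‖x‖ = 1 ∧
      ContinuousLinearMap.adjoint M (M x) = ((‖M‖ ^ 2 : ℝ) : ℂ) • x := by
  have : ProperSpace E := FiniteDimensional.proper ℂ E
  obtain ⟨x, hx, hmax⟩ := (isCompact_sphere (0 : E) 1).exists_isMaxOn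
    (NormedSpace.sphere_nonempty.2 zero_le_one) (f := fun x => ‖M x‖) (by fun_prop)
  have hx1 : ‖x‖ = 1 := by simpa using hx
  have hle : ‖M‖ ≤ ‖M x‖ := by
    refine M.opNorm_le_of_unit_norm (norm_nonneg _) fun z hz => ?_
    exact hmax (by simpa using hz)
  have heq : ‖M x‖ = ‖M‖ := le_antisymm (by simpa [hx1] using M.le_opNorm x) hle
  refine ⟨x, hx1, ?_⟩
  rw [← sub_eq_zero, ← norm_eq_zero, ← sq_eq_zero_iff]
  refine le_antisymm ?_ (sq_nonneg _)
  rw [@norm_sub_sq ℂ, inner_smul_right, ContinuousLinearMap.adjoint_inner_left,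
    inner_self_eq_norm_sq_to_K, heq, norm_smul, hx1]
  have h1 : ‖ContinuousLinearMap.adjoint M (M x)‖ ≤ ‖M‖ * ‖M‖ := by
    have h := (ContinuousLinearMap.adjoint M).le_opNorm (M x)
    rwa [heq, LinearIsometryEquiv.norm_map] at h
  have h2 : RCLike.re (((‖M‖ ^ 2 : ℝ) : ℂ) * ((‖M‖ : ℝ) : ℂ) ^ 2) = ‖M‖ ^ 4 := by
    norm_cast
    rw [RCLike.re_eq_complex_re, Complex.ofReal_re]; ring
  have h3 : ‖((‖M‖ ^ 2 : ℝ) : ℂ)‖ = ‖M‖ ^ 2 := by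
    rw [Complex.norm_real, Real.norm_of_nonneg (sq_nonneg _)]
  have h4 := mul_self_le_mul_self (norm_nonneg _) h1
  erw [h2, h3]
  nlinarith

/-- The arithmetic–geometric mean inequality for the operator norm. -/
lemma two_mul_norm_mul_mul_le [CompleteSpace E] (P N Q : E →L[ℂ] E)
    (hP : IsSelfAdjoint P) (hQ : IsSelfAdjoint Q) :
    2 * ‖P * N * Q‖ ≤ ‖P * P * N + N * (Q * Q)‖ := by
  rcases subsingleton_or_nontrivial E with hE | hE
  · have : P * N * Q = 0 := Subsingleton.elim _ _
    simp [this]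
  set σ := ‖P * N * Q‖ with hσ
  rcases (norm_nonneg (P * N * Q)).eq_or_lt with h0 | hpos
  · rw [hσ, ← h0]; simp
  obtain ⟨x, hx, hMx⟩ := exists_unit_adjoint_apply_apply (P * N * Q)
  rw [← ContinuousLinearMap.star_eq_adjoint, star_mul, star_mul, hP.star_eq, hQ.star_eq,
    ← hσ] at hMx
  set T := P * P * N + N * (Q * Q) with hT
  set p := P ((P * N * Q) x) with hp
  set q := (σ : ℂ) • Q x with hq
  have hp' : P (P (N q)) = (σ : ℂ) • p := by simp [hp, hq]
  have hq' : Q (Q (star N p)) = (σ : ℂ) • q := by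
    have : Q (star N p) = ((σ ^ 2 : ℝ) : ℂ) • x := by simpa [hp] using hMx
    rw [this, hq, map_smul, smul_smul]
    push_cast
    rw [sq]
  have hσ0 : (σ : ℂ) ≠ 0 := by exact_mod_cast hpos.ne'
  have hp0 : p ≠ 0 := by
    intro h
    have h1 : Q (star N p) = ((σ ^ 2 : ℝ) : ℂ) • x := by simpa [hp] using hMx
    rw [h, map_zero, map_zero] at h1
    have hx0 : x ≠ 0 := by rintro rfl; simp at hx
    have : ((σ ^ 2 : ℝ) : ℂ) ≠ 0 := by push_cast; exact pow_ne_zero 2 hσ0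
    exact smul_ne_zero this hx0 h1.symm
  have hsymmQ : ∀ u v : E, inner ℂ (Q u) v = inner ℂ u (Q v) := fun u v => by
    rw [← ContinuousLinearMap.adjoint_inner_right, ← ContinuousLinearMap.star_eq_adjoint,
      hQ.star_eq]
  have hinner : inner ℂ p (T q) = ((σ * (‖p‖ ^ 2 + ‖q‖ ^ 2) : ℝ) : ℂ) := by
    have e1 : T q = P (P (N q)) + N (Q (Q q)) := by simp [hT]
    have e2 : inner ℂ p (N (Q (Q q))) = inner ℂ (Q (Q (star N p))) q := by
      rw [hsymmQ, hsymmQ, ContinuousLinearMap.star_eq_adjoint,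
        ContinuousLinearMap.adjoint_inner_left]
    rw [e1, inner_add_right, e2, hp', hq', inner_smul_right, inner_smul_left,
      inner_self_eq_norm_sq_to_K, inner_self_eq_norm_sq_to_K, Complex.conj_ofReal]
    push_cast
    simp only [Complex.coe_algebraMap]
    ring
  have hbound : σ * (‖p‖ ^ 2 + ‖q‖ ^ 2) ≤ ‖p‖ * (‖T‖ * ‖q‖) := by
    have h := (norm_inner_le_norm (𝕜 := ℂ) p (T q)).trans
      (mul_le_mul_of_nonneg_left (T.le_opNorm q) (norm_nonneg p))
    rwa [hinner, Complex.norm_real, Real.norm_of_nonneg (by positivity)] at h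
  have hpp : 0 < ‖p‖ ^ 2 + ‖q‖ ^ 2 := by
    have := norm_pos_iff.2 hp0
    positivity
  refine le_of_mul_le_mul_right ?_ hpp
  nlinarith [mul_nonneg (norm_nonneg T) (sq_nonneg (‖p‖ - ‖q‖))]

end AMGM

/-- A bounded midpoint-convex function on `[s, 1 - s]` which is symmetric about `1 / 2` is
bounded by its value at the endpoints. -/
lemma le_left_of_midpoint_convex_of_symm {g : ℝ → ℝ} {s C : ℝ}
    (hsymm : ∀ v, g (1 - v) = g v)
    (hbdd : ∀ v, s ≤ v → v ≤ 1 - s → g v ≤ C)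
    (hmid : ∀ v h, 0 ≤ h → s ≤ v - h → v + h ≤ 1 - s → 2 * g v ≤ g (v - h) + g (v + h))
    {v : ℝ} (hv : s ≤ v) (hv' : v ≤ 1 - s) : g v ≤ g s := by
  have key : ∀ k : ℕ, ∀ v, s ≤ v → v ≤ 1 - s → g v - g s ≤ (C - g s) * (1 / 2) ^ k := by
    intro k
    induction k with
    | zero => intro v h1 h2; have := hbdd v h1 h2; simpa using this
    | succ k ih =>
      have half : ∀ v, s ≤ v → v ≤ 1 / 2 → g v - g s ≤ (C - g s) * (1 / 2) ^ (k + 1) := by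
        intro v h1 h2
        have h3 := hmid v (v - s) (by linarith) (by linarith) (by linarith)
        have h4 := ih (v + (v - s)) (by linarith) (by linarith)
        rw [sub_sub_cancel] at h3
        rw [pow_succ]
        linarith
      intro v h1 h2
      rcases le_total v (1 / 2) with h | h
      · exact half v h1 h
      · have := half (1 - v) (by linarith) (by linarith)
        rwa [hsymm] at this
  have hlim : Filter.Tendsto (fun k : ℕ => (C - g s) * (1 / 2 : ℝ) ^ k) Filter.atTop (nhds 0) := by
    simpa using (tendsto_pow_atTop_nhds_zero_of_lt_one (by norm_num : (0 : ℝ) ≤ 1 / 2)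
      (by norm_num)).const_mul (C - g s)
  have := ge_of_tendsto' hlim fun k => key k v hv hv'
  linarith

section Powers

variable {n : ℕ} {A : Matrix (Fin n) (Fin n) ℂ}

lemma isSelfAdjoint_mpow (A : Matrix (Fin n) (Fin n) ℂ) (v : ℝ) : IsSelfAdjoint (mpow A v) :=
  cfc_predicate _ A

lemma mpow_add (hA : A.PosSemidef) {u v : ℝ} (hu : 0 ≤ u) (hv : 0 ≤ v) :
    mpow A (u + v) = mpow A u * mpow A v := by
  have hfin : (spectrum ℝ A).Finite := Matrix.finite_real_spectrum
  unfold mpow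
  rw [← cfc_mul _ _ A (hfin.continuousOn _) (hfin.continuousOn _)]
  refine cfc_congr fun x hx => ?_
  rw [hA.isHermitian.spectrum_real_eq_range_eigenvalues] at hx
  obtain ⟨i, rfl⟩ := hx
  exact Real.rpow_add_of_nonneg (hA.eigenvalues_nonneg i) hu hv

/-- Spectral decomposition of all powers of a positive semidefinite matrix at once. -/
lemma exists_mpow_eq_sum (hA : A.PosSemidef) :
    ∃ (a : Fin n → ℝ) (P : Fin n → Matrix (Fin n) (Fin n) ℂ), (∀ i, 0 ≤ a i) ∧
      ∀ v, mpow A v = ∑ i, (a i ^ v) • P i := by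
  refine ⟨hA.isHermitian.eigenvalues, fun i =>
    (hA.isHermitian.eigenvectorUnitary : Matrix (Fin n) (Fin n) ℂ) *
      Matrix.single i i 1 * star (hA.isHermitian.eigenvectorUnitary : Matrix (Fin n) (Fin n) ℂ),
    hA.eigenvalues_nonneg, fun v => ?_⟩
  rw [mpow, hA.isHermitian.cfc_eq, Matrix.IsHermitian.cfc, Unitary.conjStarAlgAut_apply,
    ← Matrix.sum_single_eq_diagonal]
  rw [Finset.mul_sum, Finset.sum_mul]
  refine Finset.sum_congr rfl fun i _ => ?_
  rw [← smul_mul_assoc, ← mul_smul_comm, Matrix.smul_single]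
  simp

end Powers

section Heinz

open scoped Matrix.Norms.L2Operator

variable {n : ℕ} {A B : Matrix (Fin n) (Fin n) ℂ}

lemma l2OpNorm_eq_norm (M : Matrix (Fin n) (Fin n) ℂ) : l2OpNorm M = ‖M‖ := rfl

lemma two_mul_norm_matrix_mul_mul_le (P N Q : Matrix (Fin n) (Fin n) ℂ)
    (hP : IsSelfAdjoint P) (hQ : IsSelfAdjoint Q) :
    2 * ‖P * N * Q‖ ≤ ‖P * P * N + N * (Q * Q)‖ := by
  have h := two_mul_norm_mul_mul_le (Matrix.toEuclideanCLM (𝕜 := ℂ) P)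
    (Matrix.toEuclideanCLM (𝕜 := ℂ) N) (Matrix.toEuclideanCLM (𝕜 := ℂ) Q)
    (hP.map _) (hQ.map _)
  simp only [← map_mul, ← map_add] at h
  exact h

lemma exists_mpow_mul_mul_mpow_eq_sum (hA : A.PosSemidef) (hB : B.PosSemidef)
    (X : Matrix (Fin n) (Fin n) ℂ) :
    ∃ (a b : Fin n → ℝ) (C : Fin n → Fin n → Matrix (Fin n) (Fin n) ℂ),
      (∀ i, 0 ≤ a i) ∧ (∀ i, 0 ≤ b i) ∧
      ∀ u v, mpow A u * X * mpow B v = ∑ i, ∑ j, (a i ^ u * b j ^ v) • C i j := by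
  obtain ⟨a, P, ha, hP⟩ := exists_mpow_eq_sum hA
  obtain ⟨b, Q, hb, hQ⟩ := exists_mpow_eq_sum hB
  refine ⟨a, b, fun i j => P i * X * Q j, ha, hb, fun u v => ?_⟩
  rw [hP, hQ, Finset.sum_mul, Finset.sum_mul]
  refine Finset.sum_congr rfl fun i _ => ?_
  rw [Finset.mul_sum]
  refine Finset.sum_congr rfl fun j _ => ?_
  rw [smul_mul_assoc, smul_mul_assoc, mul_smul_comm, smul_smul]

lemma rpow_le_one_add {x v : ℝ} (hx : 0 ≤ x) (h0 : 0 ≤ v) (h1 : v ≤ 1) : x ^ v ≤ 1 + x := by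
  rcases le_total x 1 with h | h
  · linarith [Real.rpow_le_one hx h h0]
  · have := Real.rpow_le_rpow_of_exponent_le h h1
    rw [Real.rpow_one] at this
    linarith

lemma exists_norm_mpow_mul_mul_mpow_le (hA : A.PosSemidef) (hB : B.PosSemidef)
    (X : Matrix (Fin n) (Fin n) ℂ) :
    ∃ C, ∀ v, 0 ≤ v → v ≤ 1 → ‖mpow A v * X * mpow B (1 - v)‖ ≤ C := by
  obtain ⟨a, b, D, ha, hb, hD⟩ := exists_mpow_mul_mul_mpow_eq_sum hA hB X
  refine ⟨∑ i, ∑ j, (1 + a i) * (1 + b j) * ‖D i j‖, fun v h0 h1 => ?_⟩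
  rw [hD]
  refine norm_sum_le_of_le _ fun i _ => norm_sum_le_of_le _ fun j _ => ?_
  have hai := Real.rpow_nonneg (ha i) v
  have hbj := Real.rpow_nonneg (hb j) (1 - v)
  rw [norm_smul, Real.norm_of_nonneg (mul_nonneg hai hbj)]
  gcongr
  · linarith [ha i]
  · exact rpow_le_one_add (ha i) h0 h1
  · exact rpow_le_one_add (hb j) (by linarith) (by linarith)

lemma intervalIntegrable_mpow_mul_mul_mpow (hA : A.PosSemidef) (hB : B.PosSemidef)
    (X : Matrix (Fin n) (Fin n) ℂ) {s : ℝ} (hs0 : 0 ≤ s) (hs : s ≤ 1 / 2) :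
    IntervalIntegrable (fun v => mpow A v * X * mpow B (1 - v)) MeasureTheory.volume
      s (1 - s) := by
  obtain ⟨a, b, D, ha, hb, hD⟩ := exists_mpow_mul_mul_mpow_eq_sum hA hB X
  obtain ⟨C, hC⟩ := exists_norm_mpow_mul_mul_mpow_le hA hB X
  rw [intervalIntegrable_iff_integrableOn_Ioc_of_le (by linarith)]
  refine MeasureTheory.Measure.integrableOn_of_bounded (M := C) (by simp) ?_ ?_
  · simp only [hD]
    refine Finset.aestronglyMeasurable_fun_sum _ fun i _ =>
      Finset.aestronglyMeasurable_fun_sum _ fun j _ => ?_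
    have : Measurable fun v : ℝ => a i ^ v * b j ^ (1 - v) := by fun_prop
    exact this.aestronglyMeasurable.smul_const _
  · filter_upwards [MeasureTheory.ae_restrict_mem measurableSet_Ioc] with v hv
    exact hC v (by linarith [hv.1]) (by linarith [hv.2])

/-- The Heinz means `A ^ v X B ^ (1 - v) + A ^ (1 - v) X B ^ v` grow in norm away from
`v = 1 / 2`. -/
lemma norm_heinz_le (hA : A.PosSemidef) (hB : B.PosSemidef) (X : Matrix (Fin n) (Fin n) ℂ)
    {s v : ℝ} (hs0 : 0 ≤ s) (hv : s ≤ v) (hv' : v ≤ 1 - s) :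
    ‖mpow A v * X * mpow B (1 - v) + mpow A (1 - v) * X * mpow B v‖ ≤
      ‖mpow A s * X * mpow B (1 - s) + mpow A (1 - s) * X * mpow B s‖ := by
  obtain ⟨C, hC⟩ := exists_norm_mpow_mul_mul_mpow_le hA hB X
  refine le_left_of_midpoint_convex_of_symm (C := C + C)
    (g := fun v => ‖mpow A v * X * mpow B (1 - v) + mpow A (1 - v) * X * mpow B v‖)
    (fun v => ?_) (fun v h1 h2 => ?_) (fun v h hh h1 h2 => ?_) hv hv'
  · simp only [sub_sub_cancel]
    rw [add_comm]
  · have h3 := hC (1 - v) (by linarith) (by linarith)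
    rw [sub_sub_cancel] at h3
    exact norm_add_le_of_le (hC v (by linarith) (by linarith)) h3
  · have key := two_mul_norm_matrix_mul_mul_le (mpow A h)
      (mpow A (v - h) * X * mpow B (1 - v - h) + mpow A (1 - v - h) * X * mpow B (v - h))
      (mpow B h) (isSelfAdjoint_mpow A h) (isSelfAdjoint_mpow B h)
    have a1 : mpow A v = mpow A h * mpow A (v - h) := by
      rw [← mpow_add hA hh (by linarith)]; congr 1; ring
    have a2 : mpow A (1 - v) = mpow A h * mpow A (1 - v - h) := by
      rw [← mpow_add hA hh (by linarith)]; congr 1; ring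
    have a3 : mpow A (v + h) = mpow A h * mpow A h * mpow A (v - h) := by
      rw [mul_assoc, ← a1, ← mpow_add hA hh (by linarith)]; congr 1; ring
    have a4 : mpow A (1 - (v - h)) = mpow A h * mpow A h * mpow A (1 - v - h) := by
      rw [mul_assoc, ← a2, ← mpow_add hA hh (by linarith)]; congr 1; ring
    have b1 : mpow B v = mpow B (v - h) * mpow B h := by
      rw [← mpow_add hB (by linarith) hh]; congr 1; ring
    have b2 : mpow B (1 - v) = mpow B (1 - v - h) * mpow B h := by
      rw [← mpow_add hB (by linarith) hh]; congr 1; ring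
    have b3 : mpow B (v + h) = mpow B (v - h) * (mpow B h * mpow B h) := by
      rw [← mul_assoc, ← b1, ← mpow_add hB (by linarith) hh]
    have b4 : mpow B (1 - (v - h)) = mpow B (1 - v - h) * (mpow B h * mpow B h) := by
      rw [← mul_assoc, ← b2, ← mpow_add hB (by linarith) hh]; congr 1; ring
    refine le_trans (le_of_eq_of_le ?_ key) (le_of_eq_of_le ?_ (norm_add_le _ _))
    · rw [a1, a2, b1, b2]
      simp only [mul_add, add_mul, mul_assoc]
    · rw [a3, a4, b3, b4, show 1 - (v + h) = 1 - v - h by ring]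
      simp only [mul_add, add_mul, mul_assoc]
      abel_nf

lemma mInt_eq_integral (hA : A.PosSemidef) (hB : B.PosSemidef)
    (X : Matrix (Fin n) (Fin n) ℂ) {s : ℝ} (hs0 : 0 ≤ s) (hs : s ≤ 1 / 2) :
    mInt A B X s = ∫ v in s..(1 - s), mpow A v * X * mpow B (1 - v) := by
  have hInt := intervalIntegrable_mpow_mul_mul_mpow hA hB X hs0 hs
  ext i j
  exact (LinearMap.toContinuousLinearMap
    (Matrix.entryLinearMap ℝ ℂ i j)).intervalIntegral_comp_comm hInt

end Heinz

/-- Theorem 2.4 for the operator norm. -/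
theorem genLog_le_heinz_opNorm (n : ℕ) (A B X : Matrix (Fin n) (Fin n) ℂ)
    (hA : A.PosSemidef) (hB : B.PosSemidef) (s : ℝ) (hs0 : 0 ≤ s) (hs : s < 1 / 2) :
    l2OpNorm (mInt A B X s) ≤
      ((1 - 2 * s) / 2) *
        l2OpNorm (mpow A (1 - s) * X * mpow B s + mpow A s * X * mpow B (1 - s)) := by
  open scoped Matrix.Norms.L2Operator in
  rw [l2OpNorm_eq_norm, l2OpNorm_eq_norm, mInt_eq_integral hA hB X hs0 hs.le]
  set F : ℝ → Matrix (Fin n) (Fin n) ℂ := fun v => mpow A v * X * mpow B (1 - v) with hF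
  have hInt : IntervalIntegrable F MeasureTheory.volume s (1 - s) :=
    intervalIntegrable_mpow_mul_mul_mpow hA hB X hs0 hs.le
  have hrefl : ∫ v in s..(1 - s), F (1 - v) = ∫ v in s..(1 - s), F v := by
    rw [intervalIntegral.integral_comp_sub_left, sub_sub_cancel]
  have hInt' : IntervalIntegrable (fun v => F (1 - v)) MeasureTheory.volume s (1 - s) := by
    simpa using (hInt.comp_sub_left 1).symm
  have hdouble : (2 : ℝ) • ∫ v in s..(1 - s), F v = ∫ v in s..(1 - s), (F v + F (1 - v)) := by
    rw [intervalIntegral.integral_add hInt hInt', hrefl, two_smul]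
  have hbound := intervalIntegral.norm_integral_le_of_norm_le_const (a := s) (b := 1 - s)
    (f := fun v => F v + F (1 - v))
    (C := ‖mpow A s * X * mpow B (1 - s) + mpow A (1 - s) * X * mpow B s‖) fun v hv => by
      rw [Set.uIoc_of_le (by linarith)] at hv
      simpa [hF] using norm_heinz_le hA hB X hs0 hv.1.le hv.2
  rw [← hdouble, norm_smul, Real.norm_two, abs_of_nonneg (by linarith),
    add_comm (mpow A s * X * _)] at hbound
  linarith
end
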